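/- Let W be an elliptic curve over a field F given by a smooth Weierstrass equation with projective Weierstrass polynomial F_W ∈ F[X,Y,Z], let n' and l be positive integers with l ≥ 1, and let P_1, …, P_{3n'+l} be pairwise distinct points of W(F) with fixed representatives in F^3. Form the (3n'+l) × ((n'+1)(n'+2)/2) evaluation matrix M whose (i,m) entry is the value at the representative of P_i of the m-th degree-n' monomial in X, Y, Z. Then the left kernel of M has dimension exactly l over F; equivalently, M has rank 3n'. -/

import Mathlib

open WeierstrassCurve WeierstrassCurve.Projective

namespace EvalAux
open Polynomial
open scoped Polynomial.Bivariate

variable {F : Type*} [Field F] (W : WeierstrassCurve.Affine F)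

/-- order of the pole at infinity -/
noncomputable def ord (f : W.CoordinateRing) : WithBot ℕ := (Algebra.norm F[X] f).degree

noncomputable def xx : W.CoordinateRing := Affine.CoordinateRing.mk W (C X)
noncomputable def yy : W.CoordinateRing := Affine.CoordinateRing.mk W Y

lemma ord_xx : ord W (xx W) = 2 := by
  have h := Affine.CoordinateRing.degree_norm_smul_basis (W' := W) X 0
  rw [Affine.CoordinateRing.smul] at h
  simpa [ord, xx] using h

lemma ord_yy : ord W (yy W) = 3 := by
  have h := Affine.CoordinateRing.degree_norm_smul_basis (W' := W) 0 1
  simpa [ord, yy] using h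

lemma ord_mon (a b : ℕ) : ord W (xx W ^ a * yy W ^ b) = ((2 * a + 3 * b : ℕ) : WithBot ℕ) := by
  have h1 := ord_xx W
  have h2 := ord_yy W
  unfold ord at *
  rw [map_mul, map_pow, map_pow, degree_mul, degree_pow, degree_pow, h1, h2]
  push_cast
  simp [mul_comm]

lemma ord_add_lt {f g : W.CoordinateRing} {d : WithBot ℕ} (hf : ord W f < d) (hg : ord W g < d) :
    ord W (f + g) < d := by
  obtain ⟨p, q, rfl⟩ := Affine.CoordinateRing.exists_smul_basis_eq f
  obtain ⟨p', q', rfl⟩ := Affine.CoordinateRing.exists_smul_basis_eq g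
  have e : (p • (1 : W.CoordinateRing) + q • Affine.CoordinateRing.mk W Y) +
      (p' • (1 : W.CoordinateRing) + q' • Affine.CoordinateRing.mk W Y) =
      (p + p') • (1 : W.CoordinateRing) + (q + q') • Affine.CoordinateRing.mk W Y := by
    simp only [add_smul]; abel
  rw [e]
  unfold ord at *
  rw [Affine.CoordinateRing.degree_norm_smul_basis] at *
  refine lt_of_le_of_lt (b := max (max (2 • p.degree) (2 • q.degree + 3))
    (max (2 • p'.degree) (2 • q'.degree + 3))) ?_ (max_lt hf hg)
  have mono : Monotone (fun d : WithBot ℕ => 2 • d) := fun a b h => nsmul_le_nsmul_right h 2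
  have mono' : Monotone (fun d : WithBot ℕ => 2 • d + 3) := fun a b h => by
    dsimp only; gcongr
  have h1 := (mono (degree_add_le p p')).trans_eq (mono.map_max)
  have h2 := (mono' (degree_add_le q q')).trans_eq (mono'.map_max)
  refine max_le (h1.trans ?_) (h2.trans ?_)
  · exact max_le_max (le_max_left _ _) (le_max_left _ _)
  · exact max_le_max (le_max_right _ _) (le_max_right _ _)

lemma ord_zero : ord W 0 = ⊥ := by
  have h := Affine.CoordinateRing.degree_norm_smul_basis (W' := W) 0 0
  simpa [ord] using h

lemma ord_smul {c : F} (hc : c ≠ 0) (f : W.CoordinateRing) : ord W (c • f) = ord W f := by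
  unfold ord
  have : c • f = algebraMap F[X] _ (C c) * f := by
    rw [← Algebra.smul_def]
    exact (algebraMap_smul F[X] c f).symm
  rw [this, map_mul, degree_mul, Algebra.norm_algebraMap_of_basis (Affine.CoordinateRing.basis W),
    degree_pow, degree_C hc]
  simp

lemma ord_smul_le (c : F) (f : W.CoordinateRing) : ord W (c • f) ≤ ord W f := by
  by_cases hc : c = 0
  · simp [hc, ord_zero]
  · exact (ord_smul W hc f).le

lemma ord_sum_lt {ι : Type*} (s : Finset ι) (f : ι → W.CoordinateRing) {d : WithBot ℕ}
    (hd : ⊥ < d) (hf : ∀ i ∈ s, ord W (f i) < d) : ord W (∑ i ∈ s, f i) < d := by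
  classical
  induction s using Finset.induction_on with
  | empty => simpa [ord_zero] using hd
  | insert a s ha ih =>
    rw [Finset.sum_insert ha]
    exact ord_add_lt W (hf _ (by simp)) (ih fun i hi => hf i (by simp [hi]))

/-- evaluation at an affine point -/
noncomputable def ev {x y : F} (h : W.Equation x y) : W.CoordinateRing →ₐ[F] F :=
  AdjoinRoot.liftAlgHom W.polynomial (Polynomial.aeval x) y (by
    have : W.polynomial.evalEval x y = 0 := h
    rw [← Polynomial.eval₂_evalRingHom] at this
    convert! this using 2)

@[simp] lemma ev_xx {x y : F} (h : W.Equation x y) : ev W h (xx W) = x := by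
  simp [ev, xx]

@[simp] lemma ev_yy {x y : F} (h : W.Equation x y) : ev W h (yy W) = y := by
  simp [ev, yy]

lemma ord_ne_bot {f : W.CoordinateRing} (hf : f ≠ 0) : ord W f ≠ ⊥ := by
  obtain ⟨p, q, rfl⟩ := Affine.CoordinateRing.exists_smul_basis_eq f
  unfold ord
  rw [Affine.CoordinateRing.degree_norm_smul_basis]
  intro h
  apply hf
  have h' := le_of_eq h
  rw [max_le_iff] at h'
  have hp : p = 0 := by
    by_contra hp
    rw [degree_eq_natDegree hp] at h'
    have := h'.1
    rw [le_bot_iff, two_nsmul, ← Nat.cast_add] at this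
    exact WithBot.coe_ne_bot this
  have hq : q = 0 := by
    by_contra hq
    rw [degree_eq_natDegree hq] at h'
    have := h'.2
    rw [le_bot_iff, two_nsmul, ← Nat.cast_add] at this
    exact WithBot.coe_ne_bot (a := q.natDegree + q.natDegree + 3) this
  simp [hp, hq]

lemma finite_quot {f : W.CoordinateRing} (hf : f ≠ 0) :
    Module.Finite F (W.CoordinateRing ⧸ Ideal.span ({f} : Set W.CoordinateRing)) := by
  have h := finrank_quotient_span_eq_natDegree_norm (Affine.CoordinateRing.basis W) hf
  by_cases h0 : (Algebra.norm F[X] f).natDegree = 0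
  · have hu : IsUnit (Algebra.norm F[X] f) := by
      have h1 := ord_ne_bot W hf
      unfold ord at h1
      rw [Ne, degree_eq_bot] at h1
      rw [Polynomial.isUnit_iff_degree_eq_zero, degree_eq_natDegree h1, h0]; rfl
    have hu' : IsUnit f := by
      rw [Algebra.norm_apply] at hu
      have := Module.Finite.of_basis (Affine.CoordinateRing.basis W)
      have := LinearMap.isUnit_iff_isUnit_det _ |>.2 hu
      obtain ⟨g, hg⟩ := ((Module.End.isUnit_iff _).1 this).2 1
      exact IsUnit.of_mul_eq_one g hg
    rw [Ideal.span_singleton_eq_top.2 hu']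
    infer_instance
  · exact Module.finite_of_finrank_pos (by rw [h]; omega)

lemma card_zeros {ι : Type*} [Fintype ι] {f : W.CoordinateRing} (hf : f ≠ 0) (x y : ι → F)
    (h : ∀ i, W.Equation (x i) (y i)) (hinj : Function.Injective fun i => (x i, y i))
    (h0 : ∀ i, ev W (h i) f = 0) : (Fintype.card ι : WithBot ℕ) ≤ ord W f := by
  have h1 := finrank_quotient_span_eq_natDegree_norm (Affine.CoordinateRing.basis W) hf
  have := finite_quot W hf
  have h2 := card_algHom_le_finrank F (W.CoordinateRing ⧸ Ideal.span ({f} : Set W.CoordinateRing)) F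
  have h3 := ord_ne_bot W hf
  unfold ord at *
  rw [Ne, degree_eq_bot] at h3
  rw [degree_eq_natDegree h3, ← h1]
  refine Nat.cast_le.2 (le_trans ?_ h2)
  rw [← Nat.card_eq_fintype_card]
  let φ : ι → ((W.CoordinateRing ⧸ Ideal.span ({f} : Set W.CoordinateRing)) →ₐ[F] F) := fun i =>
    Ideal.Quotient.liftₐ _ (ev W (h i)) (fun a ha => by
      obtain ⟨b, rfl⟩ := Ideal.mem_span_singleton'.1 ha
      rw [map_mul, h0, mul_zero])
  have hφ : Function.Injective φ := by
    intro i j hij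
    apply hinj
    have e1 := DFunLike.congr_fun hij (Ideal.Quotient.mk _ (xx W))
    have e2 := DFunLike.congr_fun hij (Ideal.Quotient.mk _ (yy W))
    change ev W (h i) (xx W) = ev W (h j) (xx W) at e1
    change ev W (h i) (yy W) = ev W (h j) (yy W) at e2
    rw [ev_xx, ev_xx] at e1
    rw [ev_yy, ev_yy] at e2
    exact Prod.ext e1 e2
  exact Nat.card_le_card_of_injective φ hφ

lemma rel : xx W ^ 3 = yy W ^ 2 + W.a₁ • (xx W * yy W) + W.a₃ • yy W - W.a₂ • xx W ^ 2
    - W.a₄ • xx W - W.a₆ • (1 : W.CoordinateRing) := by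
  have h : Affine.CoordinateRing.mk W (Y ^ 2 + C (C W.a₁) * C X * Y + C (C W.a₃) * Y) =
      Affine.CoordinateRing.mk W (C X ^ 3 + C (C W.a₂) * C X ^ 2 + C (C W.a₄) * C X
        + C (C W.a₆)) := AdjoinRoot.mk_eq_mk.mpr ⟨1, by
      rw [Affine.polynomial]
      simp only [map_add, map_mul, map_pow]
      ring1⟩
  have hs : ∀ (c : F) (f : W.CoordinateRing),
      c • f = Affine.CoordinateRing.mk W (C (C c)) * f := fun c f => by
    rw [Algebra.smul_def]; rfl
  simp only [hs]
  simp only [map_add, map_mul, map_pow] at h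
  unfold xx yy
  linear_combination -h

/-- the reduced monomials -/
abbrev Idx (n : ℕ) := {ab : Fin 3 × Fin (n + 1) // (ab.1 : ℕ) + ab.2 ≤ n}

noncomputable def bas (n : ℕ) (i : Idx n) : W.CoordinateRing := xx W ^ (i.1.1 : ℕ) * yy W ^ (i.1.2 : ℕ)

lemma mem_span (n : ℕ) : ∀ a b : ℕ, a + b ≤ n →
    xx W ^ a * yy W ^ b ∈ Submodule.span F (Set.range (bas W n)) := by
  intro a
  induction a using Nat.strong_induction_on with
  | _ a ih =>
  intro b hab
  by_cases ha : a < 3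
  · exact Submodule.subset_span ⟨⟨(⟨a, ha⟩, ⟨b, by omega⟩), hab⟩, rfl⟩
  · obtain ⟨c, rfl⟩ : ∃ c, a = c + 3 := ⟨a - 3, by omega⟩
    have e : xx W ^ (c + 3) * yy W ^ b = xx W ^ c * yy W ^ (b + 2)
      + W.a₁ • (xx W ^ (c + 1) * yy W ^ (b + 1)) + W.a₃ • (xx W ^ c * yy W ^ (b + 1))
      - W.a₂ • (xx W ^ (c + 2) * yy W ^ b) - W.a₄ • (xx W ^ (c + 1) * yy W ^ b)
      - W.a₆ • (xx W ^ c * yy W ^ b) := by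
      rw [pow_add, rel]
      simp only [Algebra.smul_def]
      ring
    rw [e]
    refine Submodule.sub_mem _ (Submodule.sub_mem _ (Submodule.sub_mem _ (Submodule.add_mem _
      (Submodule.add_mem _ ?_ (Submodule.smul_mem _ _ ?_)) (Submodule.smul_mem _ _ ?_))
      (Submodule.smul_mem _ _ ?_)) (Submodule.smul_mem _ _ ?_)) (Submodule.smul_mem _ _ ?_) <;>
    exact ih _ (by omega) _ (by omega)

lemma bas_indep (n : ℕ) : LinearIndependent F (bas W n) := by
  classical
  rw [Fintype.linearIndependent_iff]
  intro g hg
  by_contra! hne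
  let s := Finset.univ.filter fun i => g i ≠ 0
  obtain ⟨i, his, hi⟩ := s.exists_max_image (fun i => 2 * (i.1.1 : ℕ) + 3 * (i.1.2 : ℕ))
    (by obtain ⟨i, hi⟩ := hne; exact ⟨i, by simp [s, hi]⟩)
  have hgi : g i ≠ 0 := by simpa [s] using his
  have e : g i • bas W n i = (-1 : F) • ∑ j ∈ Finset.univ.erase i, g j • bas W n j := by
    rw [← Finset.add_sum_erase _ _ (Finset.mem_univ i)] at hg
    rw [neg_one_smul]
    exact eq_neg_of_add_eq_zero_left hg
  have h1 : ord W (g i • bas W n i) = ((2 * i.1.1 + 3 * i.1.2 : ℕ) : WithBot ℕ) := by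
    rw [ord_smul W hgi, bas, ord_mon]
  have h2 : ord W ((-1 : F) • ∑ j ∈ Finset.univ.erase i, g j • bas W n j) <
      ((2 * i.1.1 + 3 * i.1.2 : ℕ) : WithBot ℕ) := by
    refine (ord_smul_le _ _ _).trans_lt (ord_sum_lt _ _ _ (WithBot.bot_lt_coe _) ?_)
    intro j hj
    by_cases hgj : g j = 0
    · rw [hgj, zero_smul, ord_zero]; exact WithBot.bot_lt_coe _
    · rw [ord_smul W hgj, bas, ord_mon]
      have := hi j (by simp [s, hgj])
      refine Nat.cast_lt.2 (lt_of_le_of_ne this ?_)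
      intro h
      have hji : j ≠ i := (Finset.mem_erase.1 hj).1
      apply hji
      have a1 := j.1.1.2
      have a2 := i.1.1.2
      apply Subtype.ext
      apply Prod.ext <;> apply Fin.ext <;> omega
  rw [← e, h1] at h2
  exact lt_irrefl _ h2

lemma card_idx (n : ℕ) (hn : 0 < n) : Fintype.card (Idx n) = 3 * n := by
  let f : Fin 3 × Fin n → Idx n := fun p =>
    if h : (p.1 : ℕ) + p.2 ≤ n then ⟨(p.1, ⟨p.2, by omega⟩), h⟩ else ⟨(0, ⟨n, by omega⟩), by simp⟩
  have hf : Function.Bijective f := by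
    constructor
    · rintro ⟨a, b⟩ ⟨c, d⟩ h
      have := a.2; have := b.2; have := c.2; have := d.2
      simp only [f] at h
      split_ifs at h with h1 h2 h2 <;>
        simp only [Subtype.mk.injEq, Prod.mk.injEq, Fin.ext_iff, Fin.val_zero] at h ⊢ <;> omega
    · rintro ⟨⟨a, b⟩, h⟩
      have := a.2; have := b.2
      simp only at h
      by_cases hb : (b : ℕ) = n
      · refine ⟨(2, ⟨n - 1, by omega⟩), ?_⟩
        have : ¬ ((2 : Fin 3) : ℕ) + (n - 1) ≤ n := by simp; omega
        simp only [f, this, dite_false, Subtype.mk.injEq, Prod.mk.injEq, Fin.ext_iff, Fin.val_zero]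
        omega
      · refine ⟨(a, ⟨b, by omega⟩), ?_⟩
        simp [f, h]
  rw [← Fintype.card_of_bijective hf]
  simp

end EvalAux

/-- Let `W` be an elliptic curve over `F` with projective Weierstrass polynomial `F_W`,
`n', l ≥ 1`, and `P_1, …, P_{3n'+l}` pairwise distinct points of `W(F)` with fixed
representatives.  Let `M` be the `(3n'+l) × ((n'+1)(n'+2)/2)` evaluation matrix whose
`(i, m)` entry is the value of the `m`-th degree-`n'` monomial (in a fixed ordering) at
the representative of `P_i`.  Then the left kernel of `M` has dimension exactly `l`;
equivalently, `M` has rank `3n'`. -/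
theorem left_kernel_dimension_eq
    (F : Type*) [Field F] (W : WeierstrassCurve.Projective F) [W.IsElliptic]
    (n' l : ℕ) (hn' : 0 < n') (hl : 1 ≤ l)
    (P : Fin (3 * n' + l) → W.Point) (hP : Function.Injective P)
    (rep : Fin (3 * n' + l) → Fin 3 → F) (hrep : ∀ i, (P i).point = ⟦rep i⟧)
    (mons : Fin ((n' + 1) * (n' + 2) / 2) ≃ {m : Fin 3 →₀ ℕ // ∑ t, m t = n'})
    (M : Matrix (Fin (3 * n' + l)) (Fin ((n' + 1) * (n' + 2) / 2)) F)
    (hM : ∀ i j, M i j = ∏ t, rep i t ^ ((mons j : Fin 3 →₀ ℕ) t)) :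
    Module.finrank F (LinearMap.ker M.vecMulLinear) = l ∧ M.rank = 3 * n' := by
  classical
  let A : WeierstrassCurve.Affine F := W.toAffine
  let mon : Fin ((n' + 1) * (n' + 2) / 2) → A.CoordinateRing := fun j =>
    EvalAux.xx A ^ ((mons j : Fin 3 →₀ ℕ) 0) * EvalAux.yy A ^ ((mons j : Fin 3 →₀ ℕ) 1)
  let Φ := Fintype.linearCombination F mon
  have hΦ : ∀ c, Φ c = ∑ j, c j • mon j := fun c => Fintype.linearCombination_apply F mon c
  have hsum : ∀ j, (mons j : Fin 3 →₀ ℕ) 0 + (mons j : Fin 3 →₀ ℕ) 1 +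
      (mons j : Fin 3 →₀ ℕ) 2 = n' := fun j => by
    have := (mons j).2
    rwa [Fin.sum_univ_three] at this
  have hmonle : ∀ j, EvalAux.ord A (mon j) < ((3 * n' + 1 : ℕ) : WithBot ℕ) := fun j => by
    have := hsum j
    simp only [mon, EvalAux.ord_mon]
    exact Nat.cast_lt.2 (by omega)
  let j0 := mons.symm ⟨Finsupp.single 1 n', by simp [Fin.sum_univ_three]⟩
  have hj0 : (mons j0 : Fin 3 →₀ ℕ) = Finsupp.single 1 n' := by simp [j0]
  have hj0' : ∀ j, j ≠ j0 → (mons j : Fin 3 →₀ ℕ) 1 < n' := by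
    intro j hj
    have h := hsum j
    by_contra hlt
    apply hj
    rw [← mons.apply_eq_iff_eq]
    apply Subtype.ext
    rw [hj0]
    ext t
    fin_cases t <;> simp <;> omega
  have hmonlt : ∀ j, j ≠ j0 → EvalAux.ord A (mon j) < ((3 * n' : ℕ) : WithBot ℕ) := fun j hj => by
    have := hsum j
    have := hj0' j hj
    simp only [mon, EvalAux.ord_mon]
    exact Nat.cast_lt.2 (by omega)
  have hmon0 : EvalAux.ord A (mon j0) = ((3 * n' : ℕ) : WithBot ℕ) := by
    simp only [mon, EvalAux.ord_mon, hj0]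
    simp
  have hrest : ∀ c : Fin ((n' + 1) * (n' + 2) / 2) → F,
      EvalAux.ord A (∑ j ∈ Finset.univ.erase j0, c j • mon j) < ((3 * n' : ℕ) : WithBot ℕ) :=
    fun c => EvalAux.ord_sum_lt A _ _ (WithBot.bot_lt_coe _) fun j hj =>
      (EvalAux.ord_smul_le A _ _).trans_lt (hmonlt j (Finset.mem_erase.1 hj).1)
  have hsplit : ∀ c, Φ c = c j0 • mon j0 + ∑ j ∈ Finset.univ.erase j0, c j • mon j := fun c => by
    rw [hΦ, Finset.add_sum_erase _ (fun j => c j • mon j) (Finset.mem_univ j0)]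
  have hΦ0 : ∀ c, Φ c = 0 → c j0 = 0 := by
    intro c hc
    by_contra hne
    rw [hsplit] at hc
    have e := eq_neg_of_add_eq_zero_left hc
    rw [← neg_one_smul F] at e
    have h1 : EvalAux.ord A (c j0 • mon j0) = ((3 * n' : ℕ) : WithBot ℕ) := by
      rw [EvalAux.ord_smul A hne, hmon0]
    rw [e] at h1
    exact absurd h1 (((EvalAux.ord_smul_le A _ _).trans_lt (hrest c)).ne)
  have hns : ∀ i, W.Nonsingular (rep i) := fun i => by
    have := (P i).nonsingular
    rw [hrep i] at this
    exact this
  have hinf : ∀ i, rep i 2 = 0 → ∀ c, M.mulVec c i = rep i 1 ^ n' * c j0 := by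
    intro i hz c
    have hx : rep i 0 = 0 := X_eq_zero_of_Z_eq_zero (hns i).1 hz
    rw [Matrix.mulVec, dotProduct, Finset.sum_eq_single j0]
    · rw [hM, hj0]
      simp [Fin.prod_univ_three]
    · intro j _ hj
      rw [hM, Fin.prod_univ_three, hx, hz]
      have := hsum j
      have := hj0' j hj
      by_cases h0 : (mons j : Fin 3 →₀ ℕ) 0 = 0
      · have h2 : (mons j : Fin 3 →₀ ℕ) 2 ≠ 0 := by omega
        simp [h2]
      · simp [h0]
    · simp
  have heq : ∀ i, rep i 2 ≠ 0 → A.Equation (rep i 0 / rep i 2) (rep i 1 / rep i 2) := fun i hz =>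
    (equation_of_Z_ne_zero hz).1 (hns i).1
  have haff : ∀ i, ∀ hz : rep i 2 ≠ 0, ∀ c,
      M.mulVec c i = rep i 2 ^ n' * EvalAux.ev A (heq i hz) (Φ c) := by
    intro i hz c
    rw [hΦ, map_sum, Finset.mul_sum, Matrix.mulVec, dotProduct]
    refine Finset.sum_congr rfl fun j _ => ?_
    rw [hM, map_smul, map_mul, map_pow, map_pow, EvalAux.ev_xx, EvalAux.ev_yy, Fin.prod_univ_three]
    have hp : rep i 2 ^ n' = rep i 2 ^ ((mons j : Fin 3 →₀ ℕ) 0 + (mons j : Fin 3 →₀ ℕ) 1 +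
      (mons j : Fin 3 →₀ ℕ) 2) := congrArg _ (hsum j).symm
    rw [hp, div_pow, div_pow, pow_add, pow_add, smul_eq_mul]
    field_simp
  have hker : LinearMap.ker M.mulVecLin = LinearMap.ker Φ := by
    ext c
    rw [LinearMap.mem_ker, LinearMap.mem_ker, Matrix.mulVecLin_apply]
    constructor
    · intro hc
      by_contra hne
      have hz0 : ∀ i : {i // rep i 2 ≠ 0}, EvalAux.ev A (heq i.1 i.2) (Φ c) = 0 := fun i => by
        have h := congrFun hc i.1
        rw [haff i.1 i.2, Pi.zero_apply] at h
        exact (mul_eq_zero.1 h).resolve_left (pow_ne_zero _ i.2)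
      have hcard := EvalAux.card_zeros A hne (fun i : {i // rep i 2 ≠ 0} => rep i.1 0 / rep i.1 2)
        (fun i => rep i.1 1 / rep i.1 2) (fun i => heq i.1 i.2) (by
          rintro ⟨i, hi⟩ ⟨j, hj⟩ hij
          simp only [Prod.mk.injEq] at hij
          apply Subtype.ext
          apply hP
          apply Point.ext
          rw [hrep, hrep]
          refine Quotient.sound (equiv_of_X_eq_of_Y_eq hi hj ?_ ?_)
          · exact (X_eq_iff hi hj).2 hij.1
          · exact (Y_eq_iff hi hj).2 hij.2) hz0
      have hcompl := Fintype.card_subtype_compl (fun i => rep i 2 = 0)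
      rw [Fintype.card_fin] at hcompl
      by_cases hex : ∃ i, rep i 2 = 0
      · obtain ⟨i, hi⟩ := hex
        have hc0 : c j0 = 0 := by
          have h := congrFun hc i
          rw [hinf i hi, Pi.zero_apply] at h
          exact (mul_eq_zero.1 h).resolve_left (pow_ne_zero _ (Y_ne_zero_of_Z_eq_zero (hns i) hi))
        have hlt : EvalAux.ord A (Φ c) < ((3 * n' : ℕ) : WithBot ℕ) := by
          rw [hsplit, hc0, zero_smul, zero_add]
          exact hrest c
        have h1 : Fintype.card {i // rep i 2 = 0} ≤ 1 := by
          rw [Fintype.card_le_one_iff]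
          rintro ⟨a, ha⟩ ⟨b, hb⟩
          apply Subtype.ext
          apply hP
          apply Point.ext
          rw [hrep, hrep]
          exact Quotient.sound (equiv_of_Z_eq_zero (hns a) (hns b) ha hb)
        have := Nat.cast_lt.1 (hcard.trans_lt hlt)
        have e : Fintype.card {i // rep i 2 ≠ 0} = Fintype.card {i // ¬ rep i 2 = 0} := rfl
        omega
      · have hlt : EvalAux.ord A (Φ c) < ((3 * n' + 1 : ℕ) : WithBot ℕ) := by
          rw [hΦ]
          exact EvalAux.ord_sum_lt A _ _ (WithBot.bot_lt_coe _) fun j hj =>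
            (EvalAux.ord_smul_le A _ _).trans_lt (hmonle j)
        have h1 : Fintype.card {i // rep i 2 = 0} = 0 := by
          rw [Fintype.card_eq_zero_iff]
          exact ⟨fun i => hex ⟨i.1, i.2⟩⟩
        have := Nat.cast_lt.1 (hcard.trans_lt hlt)
        have e : Fintype.card {i // rep i 2 ≠ 0} = Fintype.card {i // ¬ rep i 2 = 0} := rfl
        omega
    · intro hc
      ext i
      by_cases hz : rep i 2 = 0
      · rw [hinf i hz, hΦ0 c hc, mul_zero, Pi.zero_apply]
      · rw [haff i hz, hc, map_zero, mul_zero, Pi.zero_apply]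
  have hrange : LinearMap.range Φ = Submodule.span F (Set.range (EvalAux.bas A n')) := by
    rw [Fintype.range_linearCombination]
    apply le_antisymm
    · rw [Submodule.span_le]
      rintro _ ⟨j, rfl⟩
      exact EvalAux.mem_span A n' _ _ (by have := hsum j; omega)
    · rw [Submodule.span_le]
      rintro _ ⟨⟨⟨a, b⟩, hab⟩, rfl⟩
      apply Submodule.subset_span
      simp only at hab
      refine ⟨mons.symm ⟨Finsupp.equivFunOnFinite.symm ![a, b, n' - a - b], ?_⟩, ?_⟩
      · simp [Fin.sum_univ_three]; omega
      · simp [mon, EvalAux.bas]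
  have hfr : Module.finrank F (LinearMap.range Φ) = 3 * n' := by
    rw [hrange, finrank_span_eq_card (EvalAux.bas_indep A n'), EvalAux.card_idx n' hn']
  have hrank : M.rank = 3 * n' := by
    have h1 := LinearMap.finrank_range_add_finrank_ker M.mulVecLin
    have h2 := LinearMap.finrank_range_add_finrank_ker Φ
    rw [hker] at h1
    rw [Matrix.rank]
    omega
  refine ⟨?_, hrank⟩
  have h1 := LinearMap.finrank_range_add_finrank_ker M.vecMulLinear
  have h2 : Module.finrank F (LinearMap.range M.vecMulLinear) = 3 * n' := by
    refine Eq.trans ?_ hrank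
    rw [← Matrix.rank_transpose, Matrix.rank, Matrix.mulVecLin_transpose]
  rw [h2, Module.finrank_fin_fun] at h1
  omega
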